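/- For each n ≥ 2 let Ω_n ⊆ ℝ² be a non-special bounded convex polygonal domain with 2n edges all of length 1, normalized so that the segment with endpoints (0,0) and (1,0) is an edge of Ω_n, and suppose the Ω_n converge to an unbounded convex polygonal domain Ω_∞ with edges of length 1 whose vertices are limits of vertices of the Ω_n. If there exist two non-consecutive vertices p_i, p_j of Ω_∞ of different parity with 0 < ‖p_i − p_j‖ ≤ 1, then Ω_∞ is either a strip (the open region between two parallel straight lines) or a special unbounded convex polygonal domain. -/

import Mathlib

open Set Filter Topology Metric
open scoped RealInnerProductSpace

noncomputable section

/-- The plane `ℝ²` with the Euclidean metric. -/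
abbrev Pt : Type := EuclideanSpace ℝ (Fin 2)

/-- The point of `ℝ²` with coordinates `(a, b)`. -/
def vec2 (a b : ℝ) : Pt := (WithLp.equiv 2 (Fin 2 → ℝ)).symm ![a, b]

/-- `W_u = √(1 + ‖∇u‖²)`. -/
def Wu (u : Pt → ℝ) (p : Pt) : ℝ := Real.sqrt (1 + ‖gradient u p‖ ^ 2)

/-- The conjugate vector field `F_u = (−∂₂u/W_u, ∂₁u/W_u)` of a minimal graph `u`. -/
def conjField (u : Pt → ℝ) (p : Pt) : Pt :=
  (Wu u p)⁻¹ • vec2 (-(gradient u p 1)) (gradient u p 0)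

/-- `u` is a minimal graph on the open set `Ω`: it is `C²` on `Ω` and satisfies the minimal
surface equation `div (∇u / √(1 + ‖∇u‖²)) = 0` there, the divergence being the sum of the
partial derivatives of the components of the normalized gradient field. -/
def MinimalGraph (Ω : Set Pt) (u : Pt → ℝ) : Prop :=
  IsOpen Ω ∧ ContDiffOn ℝ 2 u Ω ∧
    ∀ p ∈ Ω, (∑ i : Fin 2,
      fderiv ℝ (fun q => (Wu u q)⁻¹ • gradient u q) p (EuclideanSpace.single i 1) i) = 0

/-- `ψ` is a conjugate function of `u` on `Ω`: it is differentiable with `∇ψ = F_u` on `Ω`. -/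
def IsConjugate (Ω : Set Pt) (u ψ : Pt → ℝ) : Prop :=
  ∀ p ∈ Ω, DifferentiableAt ℝ ψ p ∧ gradient ψ p = conjField u p

/-- The planar cross product `v₁ w₂ − v₂ w₁`. -/
def cross2 (v w : Pt) : ℝ := v 0 * w 1 - v 1 * w 0

/-- A bounded convex polygonal domain with `2n` edges, all of length one, whose vertices
`vtx 0, vtx 1, …` are listed in positively oriented cyclic order. -/
structure UnitPolygon (n : ℕ) : Type where
  n_ge : 2 ≤ n
  Ω : Set Pt
  vtx : ZMod (2 * n) → Pt
  isOpen : IsOpen Ω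
  convex : Convex ℝ Ω
  isBounded : Bornology.IsBounded Ω
  nonempty : Ω.Nonempty
  inj : Function.Injective vtx
  unit_edges : ∀ i, dist (vtx i) (vtx (i + 1)) = 1
  frontier_eq : frontier Ω = ⋃ i, segment ℝ (vtx i) (vtx (i + 1))
  pos_orient : ∀ i, 0 ≤ cross2 (vtx (i + 1) - vtx i) (vtx (i + 2) - vtx (i + 1))

/-- A bounded unit polygon with `2n` edges is special if `n ≥ 3` and its boundary is a
parallelogram with two sides of length one and two sides of length `n − 1`. -/
def UnitPolygon.IsSpecial {n : ℕ} (P : UnitPolygon n) : Prop :=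
  3 ≤ n ∧ ∃ q v w : Pt, ‖v‖ = 1 ∧ ‖w‖ = (n : ℝ) - 1 ∧
    frontier P.Ω = segment ℝ q (q + v) ∪ segment ℝ (q + v) (q + v + w) ∪
      segment ℝ (q + v + w) (q + w) ∪ segment ℝ (q + w) q

/-- The Jenkins–Serrin graph on a unit polygon: a minimal graph taking boundary values
`+∞` on the edges `(vtx (2i), vtx (2i+1))` and `−∞` on the edges `(vtx (2i−1), vtx (2i))`. -/
def JSGraph {n : ℕ} (P : UnitPolygon n) (u : Pt → ℝ) : Prop :=
  MinimalGraph P.Ω u ∧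
    ∀ i : ZMod (2 * n), ∀ t ∈ openSegment ℝ (P.vtx i) (P.vtx (i + 1)),
      (Even i.val → Tendsto u (𝓝[P.Ω] t) atTop) ∧
      (¬ Even i.val → Tendsto u (𝓝[P.Ω] t) atBot)

/-- The limit domain of a sequence of planar domains: the set of points admitting a
neighborhood contained in `Ω n` for all sufficiently large `n`. -/
def limitDomain (Ω : ℕ → Set Pt) : Set Pt :=
  {p | ∃ U ∈ 𝓝 p, ∀ᶠ n in atTop, U ⊆ Ω n}

/-- `p` is an even vertex of the limit domain: a limit of vertices `vtx (idx n)` of the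
polygons `P n` with all indices `idx n` even. -/
def IsEvenVertex (P : ∀ n : ℕ, UnitPolygon (n + 2)) (p : Pt) : Prop :=
  ∃ idx : ∀ n : ℕ, ZMod (2 * (n + 2)), (∀ n, Even ((idx n).val)) ∧
    Tendsto (fun n => (P n).vtx (idx n)) atTop (𝓝 p)

/-- `p` is an odd vertex of the limit domain: a limit of vertices `vtx (idx n)` of the
polygons `P n` with all indices `idx n` odd. -/
def IsOddVertex (P : ∀ n : ℕ, UnitPolygon (n + 2)) (p : Pt) : Prop :=
  ∃ idx : ∀ n : ℕ, ZMod (2 * (n + 2)), (∀ n, ¬ Even ((idx n).val)) ∧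
    Tendsto (fun n => (P n).vtx (idx n)) atTop (𝓝 p)

/-- `Ω` is an open strip, i.e. the open region between two parallel straight lines. -/
def IsStrip (Ω : Set Pt) : Prop :=
  ∃ (v : Pt) (c₁ c₂ : ℝ), ‖v‖ = 1 ∧ c₁ < c₂ ∧
    Ω = {x : Pt | c₁ < ⟪x, v⟫ ∧ ⟪x, v⟫ < c₂}

/-- `Ω` is a special unbounded convex polygonal domain: its boundary consists of two
parallel half-lines together with one edge of length one. -/
def IsSpecialUnbounded (Ω : Set Pt) : Prop :=
  ∃ q v w : Pt, ‖v‖ = 1 ∧ ‖w‖ = 1 ∧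
    frontier Ω = segment ℝ q (q + v) ∪
      ((fun t : ℝ => q + t • w) '' Ici (0:ℝ)) ∪
      ((fun t : ℝ => q + v + t • w) '' Ici (0:ℝ))

lemma cross2_sub_right (a b c : Pt) : cross2 a (b - c) = cross2 a b - cross2 a c := by
  simp [cross2]; ring

lemma norm_sq2 (v : Pt) : ‖v‖ ^ 2 = v 0 ^ 2 + v 1 ^ 2 := by
  rw [EuclideanSpace.norm_sq_eq]; simp

lemma inner2 (v w : Pt) : (⟪v, w⟫ : ℝ) = v 0 * w 0 + v 1 * w 1 := by
  simp [PiLp.inner_apply, Fin.sum_univ_two]; ring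

lemma unit2 {v : Pt} (h : ‖v‖ = 1) : v 0 ^ 2 + v 1 ^ 2 = 1 := by
  rw [← norm_sq2, h]; norm_num

lemma pt_ext {v w : Pt} (h0 : v 0 = w 0) (h1 : v 1 = w 1) : v = w := by
  ext i; fin_cases i
  · exact h0
  · exact h1

/-- Parallel unit vectors are equal or opposite. -/
lemma unit_parallel {v w : Pt} (hv : ‖v‖ = 1) (hw : ‖w‖ = 1) (h : cross2 v w = 0) :
    v = w ∨ v = -w := by
  have h1 := unit2 hv
  have h2 := unit2 hw
  simp only [cross2] at h
  have h3 : (v 0 * w 0 + v 1 * w 1) ^ 2 = 1 := by nlinarith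
  have h4 : (v 0 * w 0 + v 1 * w 1 - 1) * (v 0 * w 0 + v 1 * w 1 + 1) = 0 := by nlinarith
  rcases mul_eq_zero.1 h4 with h5 | h5
  · left
    have : (v 0 - w 0) ^ 2 + (v 1 - w 1) ^ 2 = 0 := by nlinarith
    apply pt_ext <;> nlinarith [sq_nonneg (v 0 - w 0), sq_nonneg (v 1 - w 1)]
  · right
    have : (v 0 + w 0) ^ 2 + (v 1 + w 1) ^ 2 = 0 := by nlinarith
    apply pt_ext <;> simp <;> nlinarith [sq_nonneg (v 0 + w 0), sq_nonneg (v 1 + w 1)]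

lemma continuous_cross2 (a : Pt) : Continuous (fun x : Pt => cross2 a x) := by
  unfold cross2; fun_prop

namespace UnitPolygon

variable {n : ℕ} (P : UnitPolygon n)

lemma seg_frontier (i : ZMod (2 * n)) : segment ℝ (P.vtx i) (P.vtx (i + 1)) ⊆ frontier P.Ω := by
  rw [P.frontier_eq]; exact subset_iUnion (fun i => segment ℝ (P.vtx i) (P.vtx (i + 1))) i

lemma vtx_frontier (i : ZMod (2 * n)) : P.vtx i ∈ frontier P.Ω :=
  P.seg_frontier i (left_mem_segment ℝ _ _)

lemma frontier_not_mem {x : Pt} (hx : x ∈ frontier P.Ω) : x ∉ P.Ω := by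
  rw [P.isOpen.frontier_eq] at hx; exact hx.2

lemma vtx_closure (i : ZMod (2 * n)) : P.vtx i ∈ closure P.Ω :=
  frontier_subset_closure (P.vtx_frontier i)

lemma edge_norm (i : ZMod (2 * n)) : ‖P.vtx (i + 1) - P.vtx i‖ = 1 := by
  rw [← P.unit_edges i, dist_eq_norm, norm_sub_rev]

lemma two_ne (P : UnitPolygon n) : (2 : ZMod (2 * n)) ≠ 0 := by
  have h := P.n_ge
  intro h2
  have : ((2 : ℕ) : ZMod (2 * n)) = 0 := by exact_mod_cast h2
  rw [ZMod.natCast_eq_zero_iff] at this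
  have := Nat.le_of_dvd (by norm_num) this
  omega

lemma edge_ne_neg (i : ZMod (2 * n)) :
    P.vtx (i + 2) - P.vtx (i + 1) ≠ -(P.vtx (i + 1) - P.vtx i) := by
  intro h
  have : P.vtx (i + 2) = P.vtx i := by
    have : P.vtx (i + 2) - P.vtx i = 0 := by
      calc _ = (P.vtx (i + 2) - P.vtx (i + 1)) + (P.vtx (i + 1) - P.vtx i) := by abel
        _ = 0 := by rw [h]; abel
    exact sub_eq_zero.1 this
  have h2 := P.inj this
  exact P.two_ne (by simpa using h2)

lemma edge_side (i : ZMod (2 * n)) :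
    (∀ x ∈ P.Ω, 0 < cross2 (P.vtx (i + 1) - P.vtx i) (x - P.vtx i)) ∨
    (∀ x ∈ P.Ω, cross2 (P.vtx (i + 1) - P.vtx i) (x - P.vtx i) < 0) := by
  set a := P.vtx i with ha
  set b := P.vtx (i + 1) with hb
  have hm : midpoint ℝ a b ∉ P.Ω :=
    P.frontier_not_mem (P.seg_frontier i (midpoint_mem_segment a b))
  obtain ⟨f, hf⟩ := geometric_hahn_banach_open_point P.convex P.isOpen hm
  have hcl : ∀ x ∈ closure P.Ω, f x ≤ f (midpoint ℝ a b) := by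
    intro x hx
    have : closure P.Ω ⊆ {x | f x ≤ f (midpoint ℝ a b)} :=
      closure_minimal (fun x hx => (hf x hx).le) (isClosed_le f.continuous continuous_const)
    exact this hx
  have h1 := hcl a (P.vtx_closure i)
  have h2 := hcl b (P.vtx_closure (i + 1))
  have hmid : f (midpoint ℝ a b) = (f a + f b) / 2 := by
    rw [midpoint_eq_smul_add, map_smul, map_add]; simp; ring
  have hab : f a = f b := by linarith
  have he := unit2 (P.edge_norm i)
  rw [← ha, ← hb] at he
  have hfe : f (b - a) = 0 := by rw [map_sub]; linarith
  have hcoord : ∀ y : Pt, f y = y 0 * f (EuclideanSpace.single 0 1) +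
      y 1 * f (EuclideanSpace.single 1 1) := by
    intro y
    have : y = y 0 • EuclideanSpace.single 0 1 + y 1 • EuclideanSpace.single 1 1 := by
      apply pt_ext <;> simp
    conv_lhs => rw [this]
    rw [map_add, map_smul, map_smul]; simp
  set c0 := f (EuclideanSpace.single 0 1)
  set c1 := f (EuclideanSpace.single 1 1)
  set e := b - a with hedef
  have hlam : ∀ y : Pt, f y = (c1 * e 0 - c0 * e 1) * cross2 e y := by
    intro y
    rw [hcoord] at hfe ⊢
    simp only [cross2]
    linear_combination (-(y 0 * c0 + y 1 * c1)) * he + (y 0 * e 0 + y 1 * e 1) * hfe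
  have hneg : ∀ x ∈ P.Ω, (c1 * e 0 - c0 * e 1) * cross2 e (x - a) < 0 := by
    intro x hx
    rw [← hlam, map_sub]
    have := hf x hx
    linarith
  rcases le_or_gt (c1 * e 0 - c0 * e 1) 0 with hl | hl
  · left
    intro x hx
    have := hneg x hx
    by_contra! hc
    nlinarith
  · right
    intro x hx
    have := hneg x hx
    by_contra! hc
    nlinarith

lemma edge_ne_zero_turn {i : ZMod (2 * n)}
    (h : cross2 (P.vtx (i + 1) - P.vtx i) (P.vtx (i + 2) - P.vtx (i + 1)) = 0) :
    P.vtx (i + 2) - P.vtx (i + 1) = P.vtx (i + 1) - P.vtx i := by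
  have h2 := P.edge_norm (i + 1)
  rw [add_assoc, one_add_one_eq_two] at h2
  rcases unit_parallel (P.edge_norm i) h2 h with h3 | h3
  · exact h3.symm
  · exact absurd (by rw [h3]; simp) (P.edge_ne_neg i)

lemma exists_turn : ∃ i : ZMod (2 * n),
    0 < cross2 (P.vtx (i + 1) - P.vtx i) (P.vtx (i + 2) - P.vtx (i + 1)) := by
  by_contra! hc
  have h0 : ∀ i : ZMod (2 * n), P.vtx (i + 2) - P.vtx (i + 1) = P.vtx (i + 1) - P.vtx i :=
    fun i => P.edge_ne_zero_turn (le_antisymm (hc i) (P.pos_orient i))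
  have h1 : ∀ k : ℕ, P.vtx ((k : ZMod (2 * n)) + 1) - P.vtx k = P.vtx 1 - P.vtx 0 := by
    intro k
    induction k with
    | zero => simp
    | succ k ih =>
      rw [← ih, ← h0 k]; push_cast; rw [add_assoc, one_add_one_eq_two]
  have h2 : ∀ k : ℕ, P.vtx (k : ZMod (2 * n)) = P.vtx 0 + (k : ℝ) • (P.vtx 1 - P.vtx 0) := by
    intro k
    induction k with
    | zero => simp
    | succ k ih =>
      have := h1 k
      push_cast
      rw [add_smul, ← add_assoc, ← ih, one_smul, ← this]; abel
  have h3 := h2 (2 * n)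
  rw [ZMod.natCast_self] at h3
  have h4 : ((2 * n : ℕ) : ℝ) • (P.vtx 1 - P.vtx 0) = 0 := by
    have := h3.symm; simpa using this
  have hn := P.n_ge
  rcases smul_eq_zero.1 h4 with h5 | h5
  · have : 2 * n = 0 := by exact_mod_cast h5
    omega
  · have := P.edge_norm 0
    rw [zero_add, h5] at this
    simp at this

lemma left_closure {i : ZMod (2 * n)}
    (h : ∀ x ∈ P.Ω, 0 < cross2 (P.vtx (i + 1) - P.vtx i) (x - P.vtx i)) :
    ∀ x ∈ closure P.Ω, 0 ≤ cross2 (P.vtx (i + 1) - P.vtx i) (x - P.vtx i) := by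
  intro x hx
  have : closure P.Ω ⊆ {x | 0 ≤ cross2 (P.vtx (i + 1) - P.vtx i) (x - P.vtx i)} :=
    closure_minimal (fun x hx => (h x hx).le) (isClosed_le continuous_const
      ((continuous_cross2 _).comp (continuous_id.sub continuous_const)))
  exact this hx

lemma right_closure {i : ZMod (2 * n)}
    (h : ∀ x ∈ P.Ω, cross2 (P.vtx (i + 1) - P.vtx i) (x - P.vtx i) < 0) :
    ∀ x ∈ closure P.Ω, cross2 (P.vtx (i + 1) - P.vtx i) (x - P.vtx i) ≤ 0 := by
  intro x hx
  have : closure P.Ω ⊆ {x | cross2 (P.vtx (i + 1) - P.vtx i) (x - P.vtx i) ≤ 0} :=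
    closure_minimal (fun x hx => (h x hx).le) (isClosed_le
      ((continuous_cross2 _).comp (continuous_id.sub continuous_const)) continuous_const)
  exact this hx

lemma left_step {i : ZMod (2 * n)}
    (h : ∀ x ∈ P.Ω, 0 < cross2 (P.vtx (i + 1) - P.vtx i) (x - P.vtx i)) :
    ∀ x ∈ P.Ω, 0 < cross2 (P.vtx (i + 1 + 1) - P.vtx (i + 1)) (x - P.vtx (i + 1)) := by
  have e2 : i + 1 + 1 = i + 2 := by ring
  rcases (P.pos_orient i).eq_or_lt with h0 | h0
  · have he := P.edge_ne_zero_turn h0.symm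
    intro x hx
    rw [e2, he]
    have := h x hx
    simp only [cross2, PiLp.sub_apply] at this ⊢
    linarith
  · rcases P.edge_side (i + 1) with h1 | h1
    · exact h1
    · have := P.right_closure h1 _ (P.vtx_closure i)
      rw [e2] at this
      simp only [cross2, PiLp.sub_apply] at this h0
      linarith

lemma left_all (i : ZMod (2 * n)) :
    ∀ x ∈ P.Ω, 0 < cross2 (P.vtx (i + 1) - P.vtx i) (x - P.vtx i) := by
  obtain ⟨i0, h0⟩ := P.exists_turn
  have hs : ∀ x ∈ P.Ω, 0 < cross2 (P.vtx (i0 + 1) - P.vtx i0) (x - P.vtx i0) := by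
    rcases P.edge_side i0 with h1 | h1
    · exact h1
    · have := P.right_closure h1 _ (P.vtx_closure (i0 + 2))
      simp only [cross2, PiLp.sub_apply] at this h0
      linarith
  have hall : ∀ k : ℕ, ∀ x ∈ P.Ω,
      0 < cross2 (P.vtx (i0 + k + 1) - P.vtx (i0 + k)) (x - P.vtx (i0 + k)) := by
    intro k
    induction k with
    | zero => simpa using hs
    | succ k ih => 
      have := P.left_step ih
      push_cast
      rw [← add_assoc]; exact this
  have hn := P.n_ge
  have : NeZero (2 * n) := ⟨by omega⟩
  have := hall (i - i0).val
  rw [ZMod.natCast_zmod_val, add_sub_cancel] at this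
  exact this

end UnitPolygon

/-- The unit vector of angle `φ`. -/
def uvec (φ : ℝ) : Pt := vec2 (Real.cos φ) (Real.sin φ)

@[simp] lemma uvec_zero (φ : ℝ) : uvec φ 0 = Real.cos φ := by simp [uvec, vec2]
@[simp] lemma uvec_one (φ : ℝ) : uvec φ 1 = Real.sin φ := by simp [uvec, vec2]

lemma uvec_norm (φ : ℝ) : ‖uvec φ‖ = 1 := by
  have h := norm_sq2 (uvec φ)
  simp at h
  exact h.resolve_right (by linarith [norm_nonneg (uvec φ)])

lemma cross_uvec (a b : ℝ) : cross2 (uvec a) (uvec b) = Real.sin (b - a) := by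
  simp [cross2, Real.sin_sub]; ring

lemma inner_uvec (a b : ℝ) : (⟪uvec a, uvec b⟫ : ℝ) = Real.cos (b - a) := by
  rw [inner2]; simp [Real.cos_sub]; ring

lemma exists_angle {v : Pt} (hv : ‖v‖ = 1) : ∃ φ : ℝ, v = uvec φ := by
  have h := unit2 hv
  have hz : ‖(⟨v 0, v 1⟩ : ℂ)‖ = 1 := by
    rw [Complex.norm_def, Complex.normSq_mk]
    rw [show v 0 * v 0 + v 1 * v 1 = 1 by nlinarith]; simp
  refine ⟨Complex.arg ⟨v 0, v 1⟩, ?_⟩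
  have hne : (⟨v 0, v 1⟩ : ℂ) ≠ 0 := by
    intro h0; rw [h0] at hz; simp at hz
  apply pt_ext
  · rw [uvec_zero, Complex.cos_arg hne, hz]; simp
  · rw [uvec_one, Complex.sin_arg, hz]; simp

/-- Next angle, with turning in `[0, π)`. -/
lemma next_angle {φ : ℝ} {v w : Pt} (hv : v = uvec φ) (hw : ‖w‖ = 1) (hc : 0 ≤ cross2 v w) :
    w = uvec (φ + Real.arccos (v 0 * w 0 + v 1 * w 1)) := by
  have h2 := unit2 hw
  have h1 := unit2 (uvec_norm φ)
  subst hv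
  set c := uvec φ 0 * w 0 + uvec φ 1 * w 1 with hcdef
  have hcs : c ^ 2 + (cross2 (uvec φ) w) ^ 2 = 1 := by
    rw [hcdef]; simp only [cross2]
    linear_combination (uvec φ 0 ^ 2 + uvec φ 1 ^ 2) * h2 + h1
  have hcos : Real.cos (Real.arccos c) = c := by
    apply Real.cos_arccos <;> nlinarith [sq_nonneg (cross2 (uvec φ) w)]
  have hsin : Real.sin (Real.arccos c) = cross2 (uvec φ) w := by
    rw [Real.sin_arccos, show 1 - c ^ 2 = (cross2 (uvec φ) w) ^ 2 by linarith, Real.sqrt_sq hc]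
  apply pt_ext
  · rw [uvec_zero, Real.cos_add, hcos, hsin, hcdef]; simp only [cross2]
    simp only [uvec_zero, uvec_one] at h1 ⊢
    linear_combination (-(w 0)) * h1
  · rw [uvec_one, Real.sin_add, hcos, hsin, hcdef]; simp only [cross2]
    simp only [uvec_zero, uvec_one] at h1 ⊢
    linear_combination (-(w 1)) * h1

namespace UnitPolygon

variable {n : ℕ} (P : UnitPolygon n)

/-- Vertices indexed by natural numbers. -/
def V (k : ℕ) : Pt := P.vtx (k : ZMod (2 * n))

/-- Edges indexed by natural numbers. -/
def E (k : ℕ) : Pt := P.V (k + 1) - P.V k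

lemma E_eq (k : ℕ) : P.E k = P.vtx ((k : ZMod (2 * n)) + 1) - P.vtx k := by
  simp [E, V]

lemma E_succ_eq (k : ℕ) : P.E (k + 1) = P.vtx ((k : ZMod (2 * n)) + 2) - P.vtx ((k : ZMod (2 * n)) + 1) := by
  simp [E, V, add_assoc, one_add_one_eq_two]

lemma E_norm (k : ℕ) : ‖P.E k‖ = 1 := by rw [E_eq]; exact P.edge_norm _

lemma V_add (k : ℕ) : P.V (k + 2 * n) = P.V k := by
  unfold V
  rw [Nat.cast_add, ZMod.natCast_self, add_zero]

lemma E_add (k : ℕ) : P.E (k + 2 * n) = P.E k := by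
  unfold E
  rw [show k + 2 * n + 1 = (k + 1) + 2 * n by ring, V_add, V_add]

lemma E_turn (k : ℕ) : 0 ≤ cross2 (P.E k) (P.E (k + 1)) := by
  rw [E_succ_eq, E_eq]; exact P.pos_orient _

lemma E_left (k : ℕ) : ∀ x ∈ closure P.Ω, 0 ≤ cross2 (P.E k) (x - P.V k) := by
  rw [E_eq]; exact P.left_closure (P.left_all _)

lemma V_closure (k : ℕ) : P.V k ∈ closure P.Ω := P.vtx_closure _

lemma V_not_mem (k : ℕ) : P.V k ∉ P.Ω := P.frontier_not_mem (P.vtx_frontier _)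

/-- The turning angle. -/
def turn (k : ℕ) : ℝ := Real.arccos (P.E k 0 * P.E (k + 1) 0 + P.E k 1 * P.E (k + 1) 1)

/-- Accumulated angle. -/
def ang (φ : ℝ) : ℕ → ℝ
  | 0 => φ
  | k + 1 => ang φ k + P.turn k

lemma turn_nonneg (k : ℕ) : 0 ≤ P.turn k := Real.arccos_nonneg _

lemma turn_lt (k : ℕ) : P.turn k < Real.pi := by
  refine lt_of_le_of_ne (Real.arccos_le_pi _) ?_
  intro h
  unfold turn at h
  rw [Real.arccos_eq_pi] at h
  have h1 := unit2 (P.E_norm k)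
  have h2 := unit2 (P.E_norm (k + 1))
  have h3 : (P.E k 0 + P.E (k + 1) 0) ^ 2 + (P.E k 1 + P.E (k + 1) 1) ^ 2 ≤ 0 := by nlinarith
  refine P.edge_ne_neg k ?_
  rw [← E_eq, ← E_succ_eq]
  apply pt_ext <;> simp <;>
    nlinarith [sq_nonneg (P.E k 0 + P.E (k + 1) 0), sq_nonneg (P.E k 1 + P.E (k + 1) 1)]

lemma turn_add (k : ℕ) : P.turn (k + 2 * n) = P.turn k := by
  unfold turn
  rw [show k + 2 * n + 1 = (k + 1) + 2 * n by ring, E_add, E_add]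

/-- If `u` has angle between those of two consecutive edges, it supports at the vertex. -/
lemma support {θ : ℕ → ℝ} (hE : ∀ k, P.E k = uvec (θ k)) {k : ℕ} {φ : ℝ} (h1 : θ k ≤ φ)
    (h2 : φ ≤ θ (k + 1)) (h3 : θ (k + 1) < θ k + Real.pi) (h4 : θ k < θ (k + 1)) :
    ∀ x ∈ closure P.Ω, 0 ≤ cross2 (uvec φ) (x - P.V (k + 1)) ∧
      (θ k < φ → φ < θ (k + 1) → cross2 (uvec φ) (x - P.V (k + 1)) = 0 → x = P.V (k + 1)) := by
  intro x hx
  have a1 := P.E_left k x hx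
  have a2 := P.E_left (k + 1) x hx
  have a1' : 0 ≤ cross2 (P.E k) (x - P.V (k + 1)) := by
    have : P.V (k + 1) = P.V k + P.E k := by simp [E]
    rw [this]
    convert a1 using 1
    simp [cross2]; ring
  set y := x - P.V (k + 1) with hy
  rw [hE] at a1' a2
  have key : Real.sin (θ (k + 1) - θ k) * cross2 (uvec φ) y =
      Real.sin (θ (k + 1) - φ) * cross2 (uvec (θ k)) y +
      Real.sin (φ - θ k) * cross2 (uvec (θ (k + 1))) y := by
    rw [← cross_uvec, ← cross_uvec, ← cross_uvec]
    simp only [cross2]; ring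
  have s0 : 0 < Real.sin (θ (k + 1) - θ k) := Real.sin_pos_of_pos_of_lt_pi (by linarith) (by linarith)
  have s1 : 0 ≤ Real.sin (θ (k + 1) - φ) := Real.sin_nonneg_of_nonneg_of_le_pi (by linarith) (by linarith)
  have s2 : 0 ≤ Real.sin (φ - θ k) := Real.sin_nonneg_of_nonneg_of_le_pi (by linarith) (by linarith)
  have p1 := mul_nonneg s1 a1'
  have p2 := mul_nonneg s2 a2
  refine ⟨?_, ?_⟩
  · by_contra! hc
    nlinarith
  · intro g1 g2 g0
    have s1 : 0 < Real.sin (θ (k + 1) - φ) := Real.sin_pos_of_pos_of_lt_pi (by linarith) (by linarith)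
    have s2 : 0 < Real.sin (φ - θ k) := Real.sin_pos_of_pos_of_lt_pi (by linarith) (by linarith)
    rw [g0, mul_zero] at key
    have z1 : cross2 (uvec (θ k)) y = 0 := by
      by_contra hne
      have := mul_pos s1 (lt_of_le_of_ne a1' (Ne.symm hne)); linarith
    have z2 : cross2 (uvec (θ (k + 1))) y = 0 := by
      by_contra hne
      have := mul_pos s2 (lt_of_le_of_ne a2 (Ne.symm hne)); linarith
    have s0' := cross_uvec (θ k) (θ (k + 1))
    have y0 : Real.sin (θ (k + 1) - θ k) * y 0 = 0 := by
      rw [← s0']; simp only [cross2] at z1 z2 ⊢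
      linear_combination (uvec (θ (k + 1)) 0) * z1 - (uvec (θ k) 0) * z2
    have y1 : Real.sin (θ (k + 1) - θ k) * y 1 = 0 := by
      rw [← s0']; simp only [cross2] at z1 z2 ⊢
      linear_combination (uvec (θ (k + 1)) 1) * z1 - (uvec (θ k) 1) * z2
    have y0' := (mul_eq_zero.1 y0).resolve_left s0.ne'
    have y1' := (mul_eq_zero.1 y1).resolve_left s0.ne'
    have : y = 0 := pt_ext (by simpa using y0') (by simpa using y1')
    rw [hy] at this
    exact sub_eq_zero.1 this

lemma V_inj {i j : ℕ} (h : i < j) (h2 : j < i + 2 * n) : P.V i ≠ P.V j := by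
  intro hij
  have := P.inj hij
  have h3 : (((j - i : ℕ)) : ZMod (2 * n)) = 0 := by
    rw [Nat.cast_sub h.le, this, sub_self]
  rw [ZMod.natCast_eq_zero_iff] at h3
  have := Nat.le_of_dvd (by omega) h3
  omega

lemma exists_lift : ∃ θ : ℕ → ℝ, Monotone θ ∧ (∀ k, θ (k + 2 * n) = θ k + 2 * Real.pi) ∧
    ∀ k, P.E k = uvec (θ k) := by
  obtain ⟨φ0, hφ0⟩ := exists_angle (P.E_norm 0)
  set θ := P.ang φ0 with hθ
  have hstep : ∀ k, θ (k + 1) = θ k + P.turn k := fun k => rfl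
  have hE : ∀ k, P.E k = uvec (θ k) := by
    intro k
    induction k with
    | zero => exact hφ0
    | succ k ih => rw [hstep]; exact next_angle ih (P.E_norm _) (P.E_turn k)
  have hmono : Monotone θ := monotone_nat_of_le_succ fun k => by
    rw [hstep]; linarith [P.turn_nonneg k]
  refine ⟨θ, hmono, ?_, hE⟩
  have hper : ∀ k, θ (k + 2 * n) - θ k = θ (2 * n) - θ 0 := by
    intro k
    induction k with
    | zero => simp
    | succ k ih =>
      rw [show k + 1 + 2 * n = (k + 2 * n) + 1 by ring, hstep, hstep, P.turn_add]; linarith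
  have hn := P.n_ge
  -- a strict corner
  obtain ⟨i, hi⟩ : ∃ i : ℕ, θ i < θ (i + 1) := by
    obtain ⟨i, hi⟩ := P.exists_turn
    have : NeZero (2 * n) := ⟨by omega⟩
    refine ⟨i.val, ?_⟩
    rw [← ZMod.natCast_zmod_val i, ← E_succ_eq, ← E_eq, hE, hE, cross_uvec] at hi
    by_contra! hc
    have := le_antisymm hc (hmono (Nat.le_succ _))
    rw [this] at hi
    simp at hi
  have hturn : θ (i + 1) < θ i + Real.pi := by rw [hstep]; linarith [P.turn_lt i]
  obtain ⟨K, hK⟩ : ∃ K : ℤ, θ (2 * n) - θ 0 = K * (2 * Real.pi) := by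
    have h1 : uvec (θ (2 * n)) = uvec (θ 0) := by
      rw [← hE, ← hE]; have := P.E_add 0; rwa [zero_add] at this
    have h2 : Real.cos (θ (2 * n) - θ 0) = 1 := by
      rw [← inner_uvec, h1, inner_uvec]; simp
    obtain ⟨K, hK⟩ := (Real.cos_eq_one_iff _).1 h2
    exact ⟨K, hK.symm⟩
  have hpi := Real.pi_pos
  have hKpos : 0 < K := by
    have : θ (i + 1) ≤ θ (i + 2 * n) := hmono (by omega)
    have h2 := hper i
    have : 0 < (K : ℝ) * (2 * Real.pi) := by rw [← hK, ← h2]; linarith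
    have : 0 < (K : ℝ) := by
      by_contra! hc; nlinarith
    exact_mod_cast this
  have hK1 : K = 1 := by
    by_contra hne
    have hK2 : (2 : ℝ) ≤ K := by
      have : 2 ≤ K := by omega
      exact_mod_cast this
    have hbig : θ i + 4 * Real.pi ≤ θ (i + 2 * n) := by
      have := hper i; nlinarith
    set φ := (θ i + θ (i + 1)) / 2 with hφ
    have hex : ∃ m, φ + 2 * Real.pi < θ (m + 1) := ⟨i + 2 * n - 1, by
      rw [show i + 2 * n - 1 + 1 = i + 2 * n by omega]; linarith⟩
    classical
    set m := Nat.find hex with hm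
    have hm1 : φ + 2 * Real.pi < θ (m + 1) := Nat.find_spec hex
    have him : i < m := by
      by_contra! hc
      have : θ (m + 1) ≤ θ (i + 1) := hmono (by omega)
      linarith
    have hm2 : θ m ≤ φ + 2 * Real.pi := by
      by_contra! hc
      have := Nat.find_min hex (m := m - 1) (by omega)
      rw [show m - 1 + 1 = m by omega] at this
      exact this hc
    have hm3 : m < i + 2 * n := by
      by_contra! hc
      have : θ (i + 2 * n) ≤ θ m := hmono hc
      linarith
    have hu : uvec (φ + 2 * Real.pi) = uvec φ := by
      apply pt_ext <;> simp
    have hmt : θ (m + 1) < θ m + Real.pi := by rw [hstep]; linarith [P.turn_lt m]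
    have q1 := (P.support hE hm2 hm1.le hmt (by linarith) _ (P.V_closure (i + 1))).1
    have q2 := P.support hE (k := i) (φ := φ) (by linarith) (by linarith) hturn hi _
      (P.V_closure (m + 1))
    rw [hu] at q1
    have q3 : cross2 (uvec φ) (P.V (m + 1) - P.V (i + 1)) = 0 := by
      apply le_antisymm _ q2.1
      rw [cross2_sub_right] at q1 ⊢
      linarith
    have q4 := q2.2 (by linarith) (by linarith) q3
    exact P.V_inj (i := i + 1) (j := m + 1) (by omega) (by omega) q4.symm
  intro k
  have := hper k
  rw [hK, hK1] at this
  push_cast at this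
  linarith

end UnitPolygon

lemma cos_add_ge {x y : ℝ} (hx : 0 ≤ x) (hy : 0 ≤ y) (hxy : x + y ≤ Real.pi) :
    1 + Real.cos (x + y) ≤ Real.cos x + Real.cos y := by
  have h1 : Real.cos x + Real.cos y = 2 * Real.cos ((x + y) / 2) * Real.cos ((x - y) / 2) :=
    Real.cos_add_cos x y
  have h2 : Real.cos (x + y) = 2 * Real.cos ((x + y) / 2) ^ 2 - 1 := by
    rw [← Real.cos_two_mul]; congr 1; ring
  have h3 : 0 ≤ Real.cos ((x + y) / 2) :=
    Real.cos_nonneg_of_neg_pi_div_two_le_of_le (by linarith [Real.pi_pos]) (by linarith)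
  have h4 : Real.cos ((x + y) / 2) ≤ Real.cos ((x - y) / 2) := by
    rw [← Real.cos_abs ((x - y) / 2)]
    apply Real.cos_le_cos_of_nonneg_of_le_pi (abs_nonneg _) (by linarith)
    rw [abs_le]; constructor <;> linarith
  rw [h1, h2]; nlinarith

namespace UnitPolygon

variable {n : ℕ} (P : UnitPolygon n)

lemma chain_inner {θ : ℕ → ℝ} (hm : Monotone θ) (hE : ∀ k, P.E k = uvec (θ k)) (h : ℕ) :
    ∀ a : ℕ, θ (a + 2 * h) - θ a ≤ Real.pi →
      1 ≤ (⟪P.V (a + 2 * h + 1) - P.V a, uvec (θ (a + h))⟫ : ℝ) := by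
  induction h with
  | zero =>
    intro a _
    have := hE a
    simp only [E] at this
    simp [this, uvec_norm]
  | succ h ih =>
    intro a ha
    have m1 : θ a ≤ θ (a + 1) := hm (by omega)
    have m2 : θ (a + 1 + 2 * h) ≤ θ (a + 2 * (h + 1)) := hm (by omega)
    have m3 : θ a ≤ θ (a + (h + 1)) := hm (by omega)
    have m4 : θ (a + (h + 1)) ≤ θ (a + 2 * (h + 1)) := hm (by omega)
    have h1 := ih (a + 1) (by linarith)
    have e1 : P.V (a + 2 * (h + 1) + 1) - P.V a = P.E a + P.E (a + 2 * (h + 1)) +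
        (P.V (a + 1 + 2 * h + 1) - P.V (a + 1)) := by
      simp only [E]
      rw [show a + 1 + 2 * h + 1 = a + 2 * (h + 1) by ring]; abel
    rw [e1, inner_add_left, inner_add_left, hE, hE, inner_uvec, inner_uvec]
    rw [show a + 1 + h = a + (h + 1) by ring] at h1
    have h2 := cos_add_ge (x := θ (a + (h + 1)) - θ a)
      (y := θ (a + 2 * (h + 1)) - θ (a + (h + 1))) (by linarith) (by linarith) (by linarith)
    have h3 : Real.cos (θ (a + (h + 1)) - θ (a + 2 * (h + 1))) =
      Real.cos (θ (a + 2 * (h + 1)) - θ (a + (h + 1))) := by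
      rw [← Real.cos_neg]; congr 1; ring
    rw [h3]
    linarith [Real.neg_one_le_cos (θ (a + (h + 1)) - θ a + (θ (a + 2 * (h + 1)) - θ (a + (h + 1))))]

lemma inner_le_dist (x y : Pt) (φ : ℝ) : (⟪x - y, uvec φ⟫ : ℝ) ≤ dist x y := by
  have := real_inner_le_norm (x - y) (uvec φ)
  rwa [uvec_norm, mul_one, ← dist_eq_norm] at this

/-- Odd chain with total turning at most `π`: the ends are far apart, more so if the extreme
edges are not opposite. -/
lemma chain_dist {θ : ℕ → ℝ} (hm : Monotone θ) (hE : ∀ k, P.E k = uvec (θ k)) (h : ℕ) (a : ℕ)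
    (ha : θ (a + 2 * h + 2) - θ a ≤ Real.pi) :
    2 + (⟪P.E a, P.E (a + 2 * h + 2)⟫ : ℝ) ≤ dist (P.V (a + 2 * h + 3)) (P.V a) := by
  have m1 : θ a ≤ θ (a + 1) := hm (by omega)
  have m2 : θ (a + 1 + 2 * h) ≤ θ (a + 2 * h + 2) := hm (by omega)
  have m3 : θ a ≤ θ (a + 1 + h) := hm (by omega)
  have m4 : θ (a + 1 + h) ≤ θ (a + 2 * h + 2) := hm (by omega)
  have h1 := P.chain_inner hm hE h (a + 1) (by linarith)
  have e1 : P.V (a + 2 * h + 3) - P.V a = P.E a + P.E (a + 2 * h + 2) +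
      (P.V (a + 1 + 2 * h + 1) - P.V (a + 1)) := by
    simp only [E]
    rw [show a + 1 + 2 * h + 1 = a + 2 * h + 2 by ring]; abel
  refine le_trans ?_ (inner_le_dist _ _ (θ (a + 1 + h)))
  rw [e1, inner_add_left, inner_add_left, hE, hE, inner_uvec, inner_uvec, inner_uvec]
  have h2 := cos_add_ge (x := θ (a + 1 + h) - θ a)
    (y := θ (a + 2 * h + 2) - θ (a + 1 + h)) (by linarith) (by linarith) (by linarith)
  have h3 : Real.cos (θ (a + 1 + h) - θ (a + 2 * h + 2)) =
    Real.cos (θ (a + 2 * h + 2) - θ (a + 1 + h)) := by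
    rw [← Real.cos_neg]; congr 1; ring
  rw [h3]
  rw [show θ (a + 1 + h) - θ a + (θ (a + 2 * h + 2) - θ (a + 1 + h)) = θ (a + 2 * h + 2) - θ a
    by ring] at h2
  linarith

/-- Vertices of different parity are at distance at least one. -/
lemma one_le_dist {i j : ℕ} (hij : i < j) (hj : j < i + 2 * n) (hodd : Odd (j - i)) :
    1 ≤ dist (P.V i) (P.V j) := by
  obtain ⟨θ, hm, hper, hE⟩ := P.exists_lift
  obtain ⟨h, hh⟩ := hodd
  have hp := hper i
  rcases le_or_gt (θ (i + 2 * h) - θ i) Real.pi with hc | hc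
  · have h1 := P.chain_inner hm hE h i hc
    rw [show i + 2 * h + 1 = j by omega] at h1
    rw [dist_comm]
    exact h1.trans (inner_le_dist _ _ _)
  · obtain ⟨h', hh'⟩ : ∃ h', i + 2 * n = j + 2 * h' + 1 := ⟨n - h - 1, by omega⟩
    have m1 : θ (j + 2 * h') ≤ θ (i + 2 * n) := hm (by omega)
    have m2 : θ (i + 2 * h) ≤ θ j := hm (by omega)
    have h1 := P.chain_inner hm hE h' j (by linarith)
    rw [← hh', P.V_add] at h1
    exact h1.trans (inner_le_dist _ _ _)

/-- Small turning chain lemma: if the chain from `t` to `s` turns at most `π/2`. -/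
lemma small_turn {θ : ℕ → ℝ} (hm : Monotone θ) (hE : ∀ k, P.E k = uvec (θ k)) (t : ℕ) (l : ℕ)
    (hl : θ (t + l) - θ t ≤ Real.pi / 2) : 1 ≤ (⟪P.V (t + l + 1) - P.V t, P.E t⟫ : ℝ) := by
  induction l with
  | zero =>
    have : P.V (t + 0 + 1) - P.V t = P.E t := rfl
    rw [this, hE]; simp [uvec_norm]
  | succ l ih =>
    have m1 : θ (t + l) ≤ θ (t + (l + 1)) := hm (by omega)
    have m2 : θ t ≤ θ (t + (l + 1)) := hm (by omega)
    have h1 := ih (by linarith)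
    have e1 : P.V (t + (l + 1) + 1) - P.V t = P.E (t + (l + 1)) + (P.V (t + l + 1) - P.V t) := by
      simp only [E]
      rw [show t + (l + 1) = t + l + 1 by ring]; abel
    rw [e1, inner_add_left]
    have : 0 ≤ (⟪P.E (t + (l + 1)), P.E t⟫ : ℝ) := by
      rw [hE, hE, inner_uvec]
      exact Real.cos_nonneg_of_neg_pi_div_two_le_of_le (by linarith) (by linarith [Real.pi_pos])
    linarith

end UnitPolygon

lemma limit_eventually_mem {Ω : ℕ → Set Pt} {x : Pt} (hx : x ∈ limitDomain Ω) {y : ℕ → Pt}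
    {l : Filter ℕ} (hl : l ≤ atTop) (hy : Tendsto y l (𝓝 x)) : ∀ᶠ n in l, y n ∈ Ω n := by
  obtain ⟨U, hU, h⟩ := hx
  filter_upwards [hl h, hy hU] with n h1 h2 using h1 h2

lemma limit_closure {Ω : ℕ → Set Pt} (hc : ∀ n, Convex ℝ (Ω n)) (ho : ∀ n, IsOpen (Ω n))
    (hne : (limitDomain Ω).Nonempty) {x : ℕ → Pt} {p : Pt} (hx : ∀ n, x n ∈ closure (Ω n))
    (hp : Tendsto x atTop (𝓝 p)) : p ∈ closure (limitDomain Ω) := by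
  obtain ⟨c, U, hU, hc0⟩ := hne
  obtain ⟨r, hr, hball⟩ := Metric.mem_nhds_iff.1 hU
  have key : ∀ t : ℝ, 0 < t → t < 1 → p + t • (c - p) ∈ limitDomain Ω := by
    intro t ht ht1
    refine ⟨ball (p + t • (c - p)) (t * (r / 2)), ball_mem_nhds _ (by positivity), ?_⟩
    have h1 : ∀ᶠ n in atTop, dist (x n) p < t * (r / 2) :=
      (Metric.tendsto_nhds.1 hp) _ (by positivity)
    filter_upwards [hc0, h1] with n h2 h3
    intro y hy
    set z := t⁻¹ • (y - (1 - t) • x n) with hz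
    have hyz : y = (1 - t) • x n + t • z := by
      rw [hz, smul_smul, mul_inv_cancel₀ ht.ne', one_smul]; abel
    have hzc : z ∈ ball c r := by
      rw [mem_ball, dist_eq_norm]
      have : z - c = t⁻¹ • ((y - (p + t • (c - p))) - (1 - t) • (x n - p)) := by
        rw [hz, eq_comm, inv_smul_eq_iff₀ ht.ne', smul_sub t (t⁻¹ • _) c, smul_smul, mul_inv_cancel₀ ht.ne']
        module
      rw [this, norm_smul, norm_inv, Real.norm_of_nonneg ht.le]
      rw [mem_ball, dist_eq_norm] at hy
      rw [dist_eq_norm] at h3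
      have h4 := norm_sub_le (y - (p + t • (c - p))) ((1 - t) • (x n - p))
      rw [norm_smul, Real.norm_of_nonneg (by linarith : 0 ≤ 1 - t)] at h4
      have h5 : (1 - t) * ‖x n - p‖ ≤ ‖x n - p‖ := by nlinarith [norm_nonneg (x n - p)]
      rw [inv_mul_lt_iff₀ ht]
      linarith
    have hzΩ : z ∈ interior (Ω n) := by rw [(ho n).interior_eq]; exact h2 (hball hzc)
    have := (hc n).combo_closure_interior_mem_interior (hx n) hzΩ (by linarith : 0 ≤ 1 - t) ht
      (by ring)
    rw [hyz]
    exact interior_subset this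
  have hlim : Tendsto (fun t : ℝ => p + t • (c - p)) (𝓝[>] 0) (𝓝 p) := by
    have : Continuous (fun t : ℝ => p + t • (c - p)) := by fun_prop
    have h := this.tendsto 0
    simp only [zero_smul, add_zero] at h
    exact h.mono_left nhdsWithin_le_nhds
  refine mem_closure_of_tendsto hlim ?_
  have : Ioo (0 : ℝ) 1 ∈ 𝓝[>] (0 : ℝ) := Ioo_mem_nhdsGT one_pos
  filter_upwards [this] with t ht using key t ht.1 ht.2

/-- Unbounded open convex sets have a recession direction. -/
lemma exists_recession {Ω : Set Pt} (ho : IsOpen Ω) (hc : Convex ℝ Ω) (hne : Ω.Nonempty)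
    (hu : ¬ Bornology.IsBounded Ω) :
    ∃ w : Pt, ‖w‖ = 1 ∧ ∀ x ∈ Ω, ∀ t : ℝ, 0 ≤ t → x + t • w ∈ Ω := by
  obtain ⟨c, hcΩ⟩ := hne
  have hex : ∀ k : ℕ, ∃ x ∈ Ω, (k : ℝ) + 1 < ‖x - c‖ := by
    intro k
    by_contra! h
    apply hu
    refine (Metric.isBounded_closedBall (x := c) (r := (k : ℝ) + 1)).subset ?_
    intro x hx
    rw [mem_closedBall, dist_eq_norm]; exact h x hx
  choose x hxΩ hx using hex
  have hpos : ∀ k, 0 < ‖x k - c‖ := fun k => by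
    have := hx k; have : (0 : ℝ) ≤ k := Nat.cast_nonneg k; linarith
  set y : ℕ → Pt := fun k => ‖x k - c‖⁻¹ • (x k - c) with hy
  have hys : ∀ k, y k ∈ sphere (0 : Pt) 1 := by
    intro k
    rw [mem_sphere_zero_iff_norm, hy]
    simp only
    rw [norm_smul, norm_inv, norm_norm, inv_mul_cancel₀ (hpos k).ne']
  obtain ⟨w, hw, φ, hφ, hlim⟩ := (isCompact_sphere (0 : Pt) 1).tendsto_subseq hys
  have hxinf : Tendsto (fun k => ‖x (φ k) - c‖) atTop atTop := by
    apply tendsto_atTop_mono (f := fun k => ((φ k : ℕ) : ℝ))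
    · intro k; have := hx (φ k); linarith
    · exact tendsto_natCast_atTop_atTop.comp hφ.tendsto_atTop
  refine ⟨w, mem_sphere_zero_iff_norm.1 hw, ?_⟩
  have hcl : ∀ z ∈ Ω, ∀ t : ℝ, 0 ≤ t → z + t • w ∈ closure Ω := by
    intro z hz t ht
    have hr : Tendsto (fun k => t * ‖x (φ k) - c‖⁻¹) atTop (𝓝 0) := by
      simpa using (tendsto_inv_atTop_zero.comp hxinf).const_mul t
    have h1 : Tendsto (fun k => (z + t • y (φ k)) + (t * ‖x (φ k) - c‖⁻¹) • (c - z)) atTop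
        (𝓝 ((z + t • w) + (0 : ℝ) • (c - z))) :=
      (tendsto_const_nhds.add (hlim.const_smul t)).add (hr.smul_const _)
    rw [zero_smul, add_zero] at h1
    refine mem_closure_of_tendsto h1 ?_
    filter_upwards [hr.eventually (gt_mem_nhds one_pos)] with k hk
    have h0 : 0 ≤ t * ‖x (φ k) - c‖⁻¹ := mul_nonneg ht (inv_nonneg.2 (norm_nonneg _))
    have := hc hz (hxΩ (φ k)) (by linarith : 0 ≤ 1 - t * ‖x (φ k) - c‖⁻¹) h0 (by ring)
    convert this using 1
    simp only [hy]
    module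
  intro z hz t ht
  have h2 := hcl z hz (2 * t) (by linarith)
  have h3 := hc.combo_interior_closure_mem_interior (by rwa [ho.interior_eq]) h2
    (by norm_num : (0 : ℝ) < 1 / 2) (by norm_num : (0 : ℝ) ≤ 1 / 2) (by norm_num)
  rw [ho.interior_eq] at h3
  convert h3 using 1
  module

lemma tendsto_cross2 {α : Type*} {l : Filter α} {f g : α → Pt} {a b : Pt}
    (hf : Tendsto f l (𝓝 a)) (hg : Tendsto g l (𝓝 b)) :
    Tendsto (fun n => cross2 (f n) (g n)) l (𝓝 (cross2 a b)) := by
  have : Continuous (fun z : Pt × Pt => cross2 z.1 z.2) := by unfold cross2; fun_prop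
  exact (this.tendsto (a, b)).comp (hf.prodMk_nhds hg)

lemma cross_alg {f g D w : Pt} (hf : ‖f‖ = 1) (hg : ‖g‖ = 1) (hD : ‖D‖ = 1) (hw : ‖w‖ = 1)
    (h1 : 0 ≤ cross2 f w) (h2 : 0 ≤ cross2 g w) (h3 : 0 ≤ cross2 f D) (h4 : cross2 g D ≤ 0)
    (h5 : f = -g ∨ (cross2 f g ≤ 0 ∧ ((⟪f, g⟫ : ℝ) ≤ 0 ∨ (⟪D, g⟫ : ℝ) ≤ 0)))
    (h6 : 0 < cross2 D w) : f = -w ∧ g = w := by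
  have hneg : f = -g → f = -w ∧ g = w := by
    intro h
    have h0 : cross2 f w = 0 := by
      apply le_antisymm _ h1
      subst h
      simp only [cross2, PiLp.neg_apply] at h2 ⊢; linarith
    rcases unit_parallel hf hw h0 with h7 | h7
    · exfalso
      rw [h7] at h3
      simp only [cross2] at h3 h6; linarith
    · exact ⟨h7, by rw [h7] at h; exact (neg_injective h).symm⟩
  rcases h5 with h5 | ⟨h5, h7⟩
  · exact hneg h5
  · have key : cross2 f g * cross2 D w = (-cross2 g D) * cross2 f w + cross2 f D * cross2 g w := by
      simp only [cross2]; ring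
    have k1 : 0 ≤ (-cross2 g D) * cross2 f w := mul_nonneg (by linarith) h1
    have k2 : 0 ≤ cross2 f D * cross2 g w := mul_nonneg h3 h2
    have h0 : cross2 f g = 0 := by
      apply le_antisymm h5
      by_contra! hc
      nlinarith
    rcases unit_parallel hf hg h0 with h8 | h8
    · exfalso
      subst h8
      rcases unit_parallel hf hD (le_antisymm h4 h3) with h9 | h9
      · subst h9
        have := unit2 hf
        rw [inner2] at h7
        rcases h7 with h7 | h7 <;> nlinarith
      · subst h9
        simp only [cross2, PiLp.neg_apply] at h1 h6; linarith
    · exact hneg h8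

lemma nonneg_of_ray {α β : ℝ} (h : ∀ τ : ℝ, 0 ≤ τ → 0 ≤ α + τ * β) : 0 ≤ β := by
  by_contra! hc
  have := h ((|α| + 1) / (-β)) (div_nonneg (by positivity) (by linarith))
  have e : (|α| + 1) / (-β) * β = -(|α| + 1) := by
    have : β ≠ 0 := hc.ne
    field_simp
  rw [e] at this
  linarith [le_abs_self α]

lemma down_step (P : ∀ n : ℕ, UnitPolygon (n + 2)) (l : Ultrafilter ℕ) (hl : (l : Filter ℕ) ≤ atTop)
    (s t : ℕ → ℕ) (hst : ∀ᶠ n in (l : Filter ℕ), (∃ h, t n = s n + 2 * h + 2) ∧ t n < s n + 2 * (n + 2))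
    {a b w c : Pt} (hb : Tendsto (fun n => (P n).V (s n)) l (𝓝 b))
    (ha : Tendsto (fun n => (P n).V (t n + 1)) l (𝓝 a)) (hab : ‖a - b‖ = 1) (hw : ‖w‖ = 1)
    (hray : ∀ τ : ℝ, 0 ≤ τ → c + τ • w ∈ limitDomain (fun n => (P n).Ω))
    (hcr : 0 < cross2 (a - b) w) :
    Tendsto (fun n => (P n).E (s n)) l (𝓝 (-w)) ∧ Tendsto (fun n => (P n).E (t n)) l (𝓝 w) := by
  have hlim : ∀ r : ℕ → ℕ, ∃ f : Pt, ‖f‖ = 1 ∧ Tendsto (fun n => (P n).E (r n)) l (𝓝 f) := by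
    intro r
    obtain ⟨f, hf, hle⟩ := (isCompact_sphere (0 : Pt) 1).ultrafilter_le_nhds'
      (l.map (fun n => (P n).E (r n))) (by
        rw [Ultrafilter.mem_map]
        refine Filter.univ_mem' fun n => ?_
        simp [(P n).E_norm])
    exact ⟨f, mem_sphere_zero_iff_norm.1 hf, hle⟩
  obtain ⟨f, hf, hfl⟩ := hlim s
  obtain ⟨g, hg, hgl⟩ := hlim t
  have hVt : Tendsto (fun n => (P n).V (t n)) l (𝓝 (a - g)) := by
    refine (ha.sub hgl).congr fun n => ?_
    simp [UnitPolygon.E]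
  have hE : ∀ (r : ℕ → ℕ) (f v : Pt), Tendsto (fun n => (P n).E (r n)) l (𝓝 f) →
      Tendsto (fun n => (P n).V (r n)) l (𝓝 v) → 0 ≤ cross2 f w := by
    intro r f v h1 h2
    apply nonneg_of_ray (α := cross2 f (c - v))
    intro τ hτ
    have hm := limit_eventually_mem (hray τ hτ) hl (y := fun _ => c + τ • w) tendsto_const_nhds
    have h3 := tendsto_cross2 h1 ((tendsto_const_nhds (x := c + τ • w)).sub h2)
    have h4 : 0 ≤ cross2 f (c + τ • w - v) := by
      refine ge_of_tendsto h3 ?_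
      filter_upwards [hm] with n hn using (P n).E_left _ _ (subset_closure hn)
    convert h4 using 1
    simp [cross2]; ring
  have h3 : 0 ≤ cross2 f (a - b) := by
    refine ge_of_tendsto (tendsto_cross2 hfl (ha.sub hb)) ?_
    exact Eventually.of_forall fun n => (P n).E_left _ _ ((P n).V_closure _)
  have h4 : cross2 g (a - b) ≤ 0 := by
    have : 0 ≤ cross2 g (b - (a - g)) := by
      refine ge_of_tendsto (tendsto_cross2 hgl (hb.sub hVt)) ?_
      exact Eventually.of_forall fun n => (P n).E_left _ _ ((P n).V_closure _)
    simp only [cross2, PiLp.sub_apply] at this ⊢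
    linarith
  choose θ hθm hθp hθE using fun n => (P n).exists_lift
  have hpi := Real.pi_pos
  have h5 : f = -g ∨ (cross2 f g ≤ 0 ∧ ((⟪f, g⟫ : ℝ) ≤ 0 ∨ (⟪a - b, g⟫ : ℝ) ≤ 0)) := by
    rcases l.em (fun n => θ n (t n) - θ n (s n) ≤ Real.pi) with hc | hc
    · left
      have h6 : 2 + (⟪f, g⟫ : ℝ) ≤ dist a b := by
        refine le_of_tendsto_of_tendsto (tendsto_const_nhds.add (hfl.inner hgl)) (ha.dist hb) ?_
        filter_upwards [hc, hst] with n h1 h2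
        obtain ⟨⟨h, h2⟩, -⟩ := h2
        rw [h2] at h1 ⊢
        exact (P n).chain_dist (hθm n) (hθE n) h (s n) h1
      rw [dist_eq_norm, hab, inner2] at h6
      have u1 := unit2 hf
      have u2 := unit2 hg
      have h7 : (f 0 + g 0) ^ 2 + (f 1 + g 1) ^ 2 ≤ 0 := by nlinarith
      apply pt_ext <;> simp <;> nlinarith [sq_nonneg (f 0 + g 0), sq_nonneg (f 1 + g 1)]
    · right
      have hle : ∀ n, t n < s n + 2 * (n + 2) → θ n (t n) ≤ θ n (s n) + 2 * Real.pi := by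
        intro n hn
        rw [← hθp n]; exact hθm n hn.le
      refine ⟨?_, ?_⟩
      · refine le_of_tendsto (tendsto_cross2 hfl hgl) ?_
        filter_upwards [hc, hst] with n h1 h2
        push Not at h1
        rw [hθE, hθE, cross_uvec]
        have h3 := hle n h2.2
        have : Real.sin (θ n (t n) - θ n (s n)) = - Real.sin (θ n (t n) - θ n (s n) - Real.pi) := by
          rw [Real.sin_sub_pi]; ring
        rw [this]
        have := Real.sin_nonneg_of_nonneg_of_le_pi (x := θ n (t n) - θ n (s n) - Real.pi)
          (by linarith) (by linarith)
        linarith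
      · rcases l.em (fun n => θ n (t n) - θ n (s n) ≤ 3 * Real.pi / 2) with hd | hd
        · left
          refine le_of_tendsto (hfl.inner hgl) ?_
          filter_upwards [hc, hd] with n h1 h2
          push Not at h1
          rw [hθE, hθE, inner_uvec]
          exact Real.cos_nonpos_of_pi_div_two_le_of_le (by linarith) (by linarith)
        · right
          have h6 : 1 ≤ (⟪b - (a - g), g⟫ : ℝ) := by
            refine ge_of_tendsto ((hb.sub hVt).inner hgl) ?_
            filter_upwards [hd, hst] with n h1 h2
            push Not at h1
            have e1 : t n + (s n + 2 * (n + 2) - 1 - t n) + 1 = s n + 2 * (n + 2) := by omega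
            have m1 : θ n (t n + (s n + 2 * (n + 2) - 1 - t n)) ≤ θ n (s n + 2 * (n + 2)) :=
              hθm n (by omega)
            have := hθp n (s n)
            have h3 := (P n).small_turn (hθm n) (hθE n) (t n) (s n + 2 * (n + 2) - 1 - t n)
              (by linarith)
            rw [e1, (P n).V_add] at h3
            exact h3
          have u2 := unit2 hg
          rw [inner2] at h6 ⊢
          simp only [PiLp.sub_apply] at h6 ⊢
          nlinarith
  obtain ⟨r1, r2⟩ := cross_alg hf hg hab hw (hE s f b hfl hb) (hE t g (a - g) hgl hVt) h3 h4 h5 hcr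
  rw [← r1, ← r2] 
  exact ⟨hfl, hgl⟩

lemma open_step {Ω : Set Pt} (ho : IsOpen Ω) {x : Pt} (hx : x ∈ Ω) (y : Pt) :
    ∃ ε : ℝ, 0 < ε ∧ x + ε • y ∈ Ω := by
  have hcont : Continuous (fun t : ℝ => x + t • y) := by fun_prop
  have h : Tendsto (fun t : ℝ => x + t • y) (𝓝[>] 0) (𝓝 x) := by
    have h := hcont.tendsto 0
    simp only [zero_smul, add_zero] at h
    exact h.mono_left nhdsWithin_le_nhds
  have h1 : ∀ᶠ t in 𝓝[>] (0 : ℝ), x + t • y ∈ Ω := h (ho.mem_nhds hx)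
  obtain ⟨ε, h2, h3⟩ := (h1.and self_mem_nhdsWithin).exists
  exact ⟨ε, h3, h2⟩

lemma closure_ray {Ω : Set Pt} {w : Pt} {t : ℝ} (h : ∀ x ∈ Ω, x + t • w ∈ Ω) :
    ∀ x ∈ closure Ω, x + t • w ∈ closure Ω := by
  intro x hx
  have hc : Continuous (fun x : Pt => x + t • w) := by fun_prop
  exact map_mem_closure (f := fun x : Pt => x + t • w) hc hx h

lemma decomp {D w : Pt} (h : 0 < cross2 D w) (b x : Pt) :
    x = b + (cross2 (x - b) w / cross2 D w) • D + (cross2 D (x - b) / cross2 D w) • w := by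
  have hne := h.ne'
  have e : ∀ i : Fin 2, cross2 D w * (x i - b i) =
      cross2 (x - b) w * D i + cross2 D (x - b) * w i := by
    intro i
    fin_cases i <;> simp [cross2] <;> ring
  ext i
  have := e i
  simp only [PiLp.add_apply, PiLp.smul_apply, smul_eq_mul]
  field_simp
  linarith

lemma strict_of_open {Ω : Set Pt} (ho : IsOpen Ω) {u b y : Pt} (hy : cross2 u y ≠ 0)
    (h : ∀ x ∈ Ω, 0 ≤ cross2 u (x - b)) : ∀ x ∈ Ω, 0 < cross2 u (x - b) := by
  intro x hx
  refine lt_of_le_of_ne (h x hx) fun h0 => ?_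
  obtain ⟨ε, hε, h1⟩ := open_step ho hx y
  obtain ⟨ε', hε', h2⟩ := open_step ho hx (-y)
  have h1 := h _ h1
  have h2 := h _ h2
  have e1 : cross2 u (x + ε • y - b) = cross2 u (x - b) + ε * cross2 u y := by
    simp [cross2]; ring
  have e2 : cross2 u (x + ε' • -y - b) = cross2 u (x - b) - ε' * cross2 u y := by
    simp [cross2]; ring
  rw [e1, ← h0, zero_add] at h1
  rw [e2, ← h0] at h2
  rcases lt_or_gt_of_ne hy with h3 | h3 <;> nlinarith

lemma strip_case {Ω : Set Pt} (ho : IsOpen Ω) (hc : Convex ℝ Ω) (hne : Ω.Nonempty) {b D w : Pt}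
    (hw : ‖w‖ = 1) (hDw : 0 < cross2 D w)
    (hb : ∀ t : ℝ, b + t • w ∈ closure Ω) (hbD : ∀ t : ℝ, b + D + t • w ∈ closure Ω)
    (h1 : ∀ x ∈ Ω, 0 ≤ cross2 (-w) (x - b)) (h2 : ∀ x ∈ Ω, 0 ≤ cross2 w (x - (b + D))) :
    IsStrip Ω := by
  have hint : interior (closure Ω) = Ω := by
    rw [hc.interior_closure_eq_interior_of_nonempty_interior (by rwa [ho.interior_eq]),
      ho.interior_eq]
  have hne1 : cross2 (-w) D ≠ 0 := by
    intro h; simp only [cross2, PiLp.neg_apply] at h hDw; linarith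
  have hne2 : cross2 w D ≠ 0 := by
    intro h; simp only [cross2] at h hDw; linarith
  have g1 := strict_of_open ho hne1 h1
  have g2 := strict_of_open ho hne2 h2
  set v : Pt := vec2 (w 1) (-(w 0)) with hv
  have hv0 : v 0 = w 1 := by simp [hv, vec2]
  have hv1 : v 1 = -(w 0) := by simp [hv, vec2]
  have hin : ∀ x : Pt, (⟪x, v⟫ : ℝ) = cross2 x w := by
    intro x; rw [inner2, hv0, hv1]; simp only [cross2]; ring
  refine ⟨v, cross2 b w, cross2 (b + D) w, ?_, ?_, ?_⟩
  · have := norm_sq2 v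
    rw [hv0, hv1] at this
    have hu := unit2 hw
    have h3 : ‖v‖ ^ 2 = 1 := by rw [this]; nlinarith
    nlinarith [norm_nonneg v]
  · simp only [cross2, PiLp.add_apply] at hDw ⊢; linarith
  · apply Subset.antisymm
    · intro x hx
      have g1 := g1 x hx
      have g2 := g2 x hx
      simp only [mem_setOf_eq, hin]
      simp only [cross2, PiLp.add_apply, PiLp.neg_apply, PiLp.sub_apply] at *
      constructor <;> linarith
    · have hop : IsOpen {x : Pt | cross2 b w < (⟪x, v⟫ : ℝ) ∧ (⟪x, v⟫ : ℝ) < cross2 (b + D) w} := by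
        have hcv : Continuous (fun x : Pt => (⟪x, v⟫ : ℝ)) := by fun_prop
        exact (isOpen_lt continuous_const hcv).inter (isOpen_lt hcv continuous_const)
      have hsub : {x : Pt | cross2 b w < (⟪x, v⟫ : ℝ) ∧ (⟪x, v⟫ : ℝ) < cross2 (b + D) w} ⊆
          closure Ω := by
        intro x hx
        simp only [mem_setOf_eq, hin] at hx
        have hd := decomp hDw b x
        set α := cross2 (x - b) w / cross2 D w with hα
        set β := cross2 D (x - b) / cross2 D w
        have e1 : cross2 (x - b) w = cross2 x w - cross2 b w := by simp [cross2]; ring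
        have e2 : cross2 (b + D) w = cross2 b w + cross2 D w := by simp [cross2]; ring
        have hα0 : 0 ≤ α := div_nonneg (by linarith) hDw.le
        have hα1 : α ≤ 1 := by rw [hα, div_le_one hDw]; linarith
        have := hc.closure (hb β) (hbD β) (by linarith : 0 ≤ 1 - α) hα0 (by ring)
        rw [hd]
        convert this using 1
        module
      have := interior_maximal hsub hop
      rwa [hint] at this

lemma special_case {Ω : Set Pt} (ho : IsOpen Ω) (hc : Convex ℝ Ω) (hne : Ω.Nonempty) {b D w : Pt}
    (hw : ‖w‖ = 1) (hD : ‖D‖ = 1) (hDw : 0 < cross2 D w)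
    (hb : ∀ t : ℝ, 0 ≤ t → b + t • w ∈ closure Ω)
    (hbD : ∀ t : ℝ, 0 ≤ t → b + D + t • w ∈ closure Ω)
    (h1 : ∀ x ∈ Ω, 0 ≤ cross2 (-w) (x - b)) (h2 : ∀ x ∈ Ω, 0 ≤ cross2 w (x - (b + D)))
    (h3 : ∀ x ∈ Ω, 0 ≤ cross2 D (x - b)) : IsSpecialUnbounded Ω := by
  have hint : interior (closure Ω) = Ω := by
    rw [hc.interior_closure_eq_interior_of_nonempty_interior (by rwa [ho.interior_eq]),
      ho.interior_eq]
  have hne1 : cross2 (-w) D ≠ 0 := by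
    intro h; simp only [cross2, PiLp.neg_apply] at h hDw; linarith
  have hne2 : cross2 w D ≠ 0 := by
    intro h; simp only [cross2] at h hDw; linarith
  have g1 := strict_of_open ho hne1 h1
  have g2 := strict_of_open ho hne2 h2
  have g3 := strict_of_open ho hDw.ne' h3
  have hcont : ∀ u c : Pt, Continuous (fun x : Pt => cross2 u (x - c)) := by
    intro u c; unfold cross2; fun_prop
  have hclo : ∀ u c : Pt, (∀ x ∈ Ω, 0 ≤ cross2 u (x - c)) →
      ∀ x ∈ closure Ω, 0 ≤ cross2 u (x - c) := by
    intro u c h x hx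
    have : closure Ω ⊆ {x | 0 ≤ cross2 u (x - c)} :=
      closure_minimal h (isClosed_le continuous_const (hcont u c))
    exact this hx
  -- closed half-strip is in the closure
  have hin : ∀ α β : ℝ, 0 ≤ α → α ≤ 1 → 0 ≤ β → b + α • D + β • w ∈ closure Ω := by
    intro α β ha ha1 hβ
    have := hc.closure (hb β hβ) (hbD β hβ) (by linarith : 0 ≤ 1 - α) ha (by ring)
    convert this using 1
    module
  have hcoord : ∀ x, cross2 (-w) (x - b) = cross2 (x - b) w := by
    intro x; simp [cross2]; ring
  have hcoord2 : ∀ x, cross2 w (x - (b + D)) = cross2 D w - cross2 (x - b) w := by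
    intro x; simp [cross2]; ring
  have hΩ : ∀ x, x ∈ Ω ↔ 0 < cross2 (-w) (x - b) ∧ 0 < cross2 w (x - (b + D)) ∧
      0 < cross2 D (x - b) := by
    intro x
    refine ⟨fun hx => ⟨g1 x hx, g2 x hx, g3 x hx⟩, fun hx => ?_⟩
    have hop : IsOpen {x : Pt | 0 < cross2 (-w) (x - b) ∧ 0 < cross2 w (x - (b + D)) ∧
      0 < cross2 D (x - b)} :=
      (isOpen_lt continuous_const (hcont _ _)).inter
        ((isOpen_lt continuous_const (hcont _ _)).inter (isOpen_lt continuous_const (hcont _ _)))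
    have hsub : {x : Pt | 0 < cross2 (-w) (x - b) ∧ 0 < cross2 w (x - (b + D)) ∧
      0 < cross2 D (x - b)} ⊆ closure Ω := by
      rintro x ⟨k1, k2, k3⟩
      rw [hcoord] at k1
      rw [hcoord2] at k2
      rw [decomp hDw b x]
      apply hin
      · exact div_nonneg k1.le hDw.le
      · rw [div_le_one hDw]; linarith
      · exact div_nonneg k3.le hDw.le
    have := interior_maximal hsub hop
    rw [hint] at this
    exact this hx
  refine ⟨b, D, w, hD, hw, ?_⟩
  rw [ho.frontier_eq]
  apply Subset.antisymm
  · rintro x ⟨hx, hx'⟩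
    have k1 := hclo _ _ h1 x hx
    have k2 := hclo _ _ h2 x hx
    have k3 := hclo _ _ h3 x hx
    rw [hΩ, hcoord, hcoord2] at hx'
    rw [hcoord] at k1
    rw [hcoord2] at k2
    have hd := decomp hDw b x
    rcases k1.eq_or_lt with z1 | z1
    · left; right
      refine ⟨cross2 D (x - b) / cross2 D w, div_nonneg k3 hDw.le, ?_⟩
      simp only
      conv_rhs => rw [hd, ← z1]
      simp
    rcases k2.eq_or_lt with z2 | z2
    · right
      refine ⟨cross2 D (x - b) / cross2 D w, div_nonneg k3 hDw.le, ?_⟩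
      simp only
      conv_rhs => rw [hd, show cross2 (x - b) w = cross2 D w by linarith, div_self hDw.ne', one_smul]
    rcases k3.eq_or_lt with z3 | z3
    · left; left
      rw [segment_eq_image']
      refine ⟨cross2 (x - b) w / cross2 D w, ⟨div_nonneg k1 hDw.le, ?_⟩, ?_⟩
      · rw [div_le_one hDw]; linarith
      · simp only
        conv_rhs => rw [hd, ← z3]
        simp
    · exact absurd ⟨z1, z2, z3⟩ hx'
  · rintro x ((hx | ⟨t, ht, rfl⟩) | ⟨t, ht, rfl⟩)
    · rw [segment_eq_image'] at hx
      obtain ⟨t, ht, rfl⟩ := hx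
      simp only [add_sub_cancel_left]
      refine ⟨by simpa using hin t 0 ht.1 ht.2 le_rfl, ?_⟩
      rw [hΩ]
      rintro ⟨-, -, h⟩
      simp [cross2] at h
      linarith
    · refine ⟨hb t ht, ?_⟩
      rw [hΩ]
      rintro ⟨h, -, -⟩
      simp [cross2] at h
      linarith
    · refine ⟨hbD t ht, ?_⟩
      rw [hΩ]
      rintro ⟨-, h, -⟩
      simp [cross2] at h
      linarith

lemma core (P : ∀ n : ℕ, UnitPolygon (n + 2)) (Ωinf : Set Pt)
    (hΩ : Ωinf = limitDomain (fun n => (P n).Ω))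
    (hopen : IsOpen Ωinf) (hconv : Convex ℝ Ωinf) (hne : Ωinf.Nonempty)
    (I J K : ℕ → ℕ) (hIJ : ∀ n, I n < J n) (hK : ∀ n, I n + 2 * (n + 2) = J n + 2 * K n + 1)
    {p q w x0 : Pt} (hp : Tendsto (fun n => (P n).V (I n)) atTop (𝓝 p))
    (hq : Tendsto (fun n => (P n).V (J n)) atTop (𝓝 q)) (hpq : ‖p - q‖ = 1)
    (hx0 : x0 ∈ segment ℝ p q) (hx0' : x0 ∈ Ωinf) (hw : ‖w‖ = 1)
    (hrec : ∀ x ∈ Ωinf, ∀ t : ℝ, 0 ≤ t → x + t • w ∈ Ωinf) (hcr : 0 < cross2 (p - q) w) :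
    IsStrip Ωinf ∨ IsSpecialUnbounded Ωinf := by
  have hVc : ∀ (r : ℕ → ℕ) (z : Pt), Tendsto (fun n => (P n).V (r n)) atTop (𝓝 z) →
      z ∈ closure Ωinf := by
    intro r z hz
    rw [hΩ] at hne ⊢
    exact limit_closure (fun n => (P n).convex) (fun n => (P n).isOpen) hne
      (fun n => (P n).V_closure _) hz
  have hleft : ∀ (r : ℕ → ℕ) (f v : Pt), Tendsto (fun n => (P n).E (r n)) atTop (𝓝 f) →
      Tendsto (fun n => (P n).V (r n)) atTop (𝓝 v) → ∀ x ∈ Ωinf, 0 ≤ cross2 f (x - v) := by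
    intro r f v h1 h2 x hx
    rw [hΩ] at hx
    have hm := limit_eventually_mem hx le_rfl (y := fun _ => x) tendsto_const_nhds
    refine ge_of_tendsto (tendsto_cross2 h1 (tendsto_const_nhds.sub h2)) ?_
    filter_upwards [hm] with n hn using (P n).E_left _ _ (subset_closure hn)
  have hedge : ∀ s : ℕ, (∀ᶠ n in atTop, s < K n) →
      Tendsto (fun n => (P n).V (J n + s)) atTop (𝓝 (q - (s : ℝ) • w)) →
      Tendsto (fun n => (P n).V (J n + 2 * K n + 1 - s)) atTop (𝓝 (p - (s : ℝ) • w)) →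
      Tendsto (fun n => (P n).E (J n + s)) atTop (𝓝 (-w)) ∧
      Tendsto (fun n => (P n).E (J n + 2 * K n - s)) atTop (𝓝 w) := by
    intro s hs hb ha
    have hab : p - (s : ℝ) • w - (q - (s : ℝ) • w) = p - q := by abel
    have key : ∀ l : Ultrafilter ℕ, (l : Filter ℕ) ≤ atTop →
      Tendsto (fun n => (P n).E (J n + s)) l (𝓝 (-w)) ∧
      Tendsto (fun n => (P n).E (J n + 2 * K n - s)) l (𝓝 w) := by
      intro l hl
      refine down_step P l hl (fun n => J n + s) (fun n => J n + 2 * K n - s) ?_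
        (a := p - (s : ℝ) • w) (b := q - (s : ℝ) • w) (c := x0) (hb.mono_left hl) ?_
        (by rw [hab]; exact hpq) hw ?_ (by rw [hab]; exact hcr)
      · filter_upwards [hl hs] with n hn
        refine ⟨⟨K n - s - 1, by omega⟩, ?_⟩
        have := hK n
        have := hIJ n
        omega
      · refine (ha.mono_left hl).congr' ?_
        filter_upwards [hl hs] with n hn
        congr 1
        omega
      · intro τ hτ
        rw [← hΩ]; exact hrec x0 hx0' τ hτ
    exact ⟨tendsto_iff_ultrafilter _ _ _ |>.2 fun l hl => (key l hl).1,
      tendsto_iff_ultrafilter _ _ _ |>.2 fun l hl => (key l hl).2⟩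
  have hpos : ∀ s : ℕ, (∀ᶠ n in atTop, s ≤ K n) →
      Tendsto (fun n => (P n).V (J n + s)) atTop (𝓝 (q - (s : ℝ) • w)) ∧
      Tendsto (fun n => (P n).V (J n + 2 * K n + 1 - s)) atTop (𝓝 (p - (s : ℝ) • w)) := by
    intro s
    induction s with
    | zero =>
      intro _
      refine ⟨by simpa using hq, ?_⟩
      simp only [Nat.cast_zero, zero_smul, sub_zero]
      refine hp.congr fun n => ?_
      rw [← hK n, Nat.sub_zero, (P n).V_add]
    | succ s ih =>
      intro hs
      have hs' : ∀ᶠ n in atTop, s < K n := by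
        filter_upwards [hs] with n hn using hn
      obtain ⟨hb, ha⟩ := ih (hs'.mono fun n hn => hn.le)
      obtain ⟨e1, e2⟩ := hedge s hs' hb ha
      constructor
      · have := hb.add e1
        have e : q - ((s + 1 : ℕ) : ℝ) • w = q - (s : ℝ) • w + -w := by push_cast; module
        rw [e]
        refine this.congr fun n => ?_
        simp only [UnitPolygon.E]
        rw [← add_assoc]; abel
      · have := ha.sub e2
        have e : p - ((s + 1 : ℕ) : ℝ) • w = p - (s : ℝ) • w - w := by push_cast; module
        rw [e]
        refine this.congr' ?_
        filter_upwards [hs'] with n hn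
        simp only [UnitPolygon.E]
        rw [show J n + 2 * K n - s + 1 = J n + 2 * K n + 1 - s by omega,
          show J n + 2 * K n + 1 - (s + 1) = J n + 2 * K n - s by omega]
        abel
  have hsides : (∀ᶠ n in atTop, 0 < K n) → (∀ x ∈ Ωinf, 0 ≤ cross2 (-w) (x - q)) ∧
      (∀ x ∈ Ωinf, 0 ≤ cross2 w (x - p)) := by
    intro hs
    obtain ⟨hb, ha⟩ := hpos 0 (Eventually.of_forall fun n => Nat.zero_le _)
    obtain ⟨e1, e2⟩ := hedge 0 hs hb ha
    constructor
    · exact hleft _ _ _ e1 (by simpa using hb)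
    · intro x hx
      have h3 : Tendsto (fun n => (P n).V (J n + 2 * K n - 0)) atTop (𝓝 (p - w)) := by
        have := ha.sub e2
        simp only [Nat.cast_zero, zero_smul, sub_zero] at this
        refine this.congr fun n => ?_
        simp [UnitPolygon.E]
      have := hleft _ _ _ e2 h3 x hx
      simp only [cross2, PiLp.sub_apply] at this ⊢
      linarith
  have hrecc : ∀ x ∈ closure Ωinf, ∀ t : ℝ, 0 ≤ t → x + t • w ∈ closure Ωinf :=
    fun x hx t ht => closure_ray (fun y hy => hrec y hy t ht) x hx
  by_cases hinf : ∀ s : ℕ, ∀ᶠ n in atTop, s < K n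
  · left
    obtain ⟨s1, s2⟩ := hsides (hinf 0)
    have hline : ∀ z : Pt, (∀ s : ℕ, z - (s : ℝ) • w ∈ closure Ωinf) →
        ∀ t : ℝ, z + t • w ∈ closure Ωinf := by
      intro z hz t
      obtain ⟨s, hs⟩ := exists_nat_ge (-t)
      have := hrecc _ (hz s) (t + s) (by linarith)
      convert this using 1
      module
    refine strip_case hopen hconv hne (b := q) (D := p - q) hw hcr ?_ ?_ s1 ?_
    · exact hline q fun s => hVc _ _ (hpos s ((hinf s).mono fun n hn => hn.le)).1
    · rw [add_sub_cancel]
      exact hline p fun s => hVc _ _ (hpos s ((hinf s).mono fun n hn => hn.le)).2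
    · rw [add_sub_cancel]; exact s2
  · right
    classical
    have hex : ∃ s : ℕ, ¬ ∀ᶠ n in atTop, s < K n := not_forall.1 hinf
    set s0 := Nat.find hex with hs0
    have hspec := Nat.find_spec hex
    rw [← hs0] at hspec
    have hge : ∀ᶠ n in atTop, s0 ≤ K n := by
      rcases Nat.eq_zero_or_pos s0 with h | h
      · rw [h]; exact Eventually.of_forall fun n => Nat.zero_le _
      · have := Nat.find_min hex (m := s0 - 1) (by omega)
        rw [not_not] at this
        filter_upwards [this] with n hn
        omega
    have hfreq : ∃ᶠ n in atTop, K n = s0 := by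
      have h1 : ∃ᶠ n in atTop, ¬ s0 < K n := Filter.not_eventually.1 hspec
      refine (h1.and_eventually hge).mono fun n hn => ?_
      omega
    obtain ⟨hb, ha⟩ := hpos s0 hge
    have hab : p - (s0 : ℝ) • w - (q - (s0 : ℝ) • w) = p - q := by abel
    have hcap : ∀ x ∈ Ωinf, 0 ≤ cross2 (p - q) (x - (q - (s0 : ℝ) • w)) := by
      intro x hx
      rw [hΩ] at hx
      have hm := limit_eventually_mem hx le_rfl (y := fun _ => x) tendsto_const_nhds
      have hl := tendsto_cross2 (ha.sub hb) ((tendsto_const_nhds (x := x)).sub hb)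
      rw [hab] at hl
      refine ge_of_tendsto_of_frequently hl ?_
      refine (hfreq.and_eventually hm).mono fun n hn => ?_
      have := (P n).E_left (J n + s0) x (subset_closure hn.2)
      simp only [UnitPolygon.E] at this
      rw [show J n + 2 * K n + 1 - s0 = J n + s0 + 1 by omega]
      exact this
    have hs0pos : 0 < s0 := by
      by_contra! hz
      have hz : s0 = 0 := by omega
      rw [hz] at hcap
      simp only [Nat.cast_zero, zero_smul, sub_zero] at hcap
      have := strict_of_open hopen hcr.ne' hcap x0 hx0'
      rw [segment_eq_image'] at hx0
      obtain ⟨t, -, rfl⟩ := hx0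
      simp [cross2] at this
      linarith
    obtain ⟨s1, s2⟩ := hsides (hge.mono fun n hn => by omega)
    refine special_case hopen hconv hne (b := q - (s0 : ℝ) • w) (D := p - q) hw hpq hcr ?_ ?_ ?_ ?_
      hcap
    · intro t ht
      exact hrecc _ (hVc _ _ hb) t ht
    · intro t ht
      have := hrecc _ (hVc _ _ ha) t ht
      convert this using 1
      module
    · intro x hx
      have := s1 x hx
      simp [cross2] at this ⊢
      linarith
    · intro x hx
      have := s2 x hx
      simp [cross2] at this ⊢
      linarith

/-- If the limit `Ω_∞` of the normalized non-special unit polygons `Ω_n` has two distinct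
non-consecutive vertices of different parity at distance in `(0, 1]`, then `Ω_∞` is either
a strip or a special unbounded convex polygonal domain. -/
theorem limit_domain_strip_or_special
    (P : ∀ n : ℕ, UnitPolygon (n + 2))
    (hns : ∀ n, ¬ (P n).IsSpecial)
    (hv0 : ∀ n, (P n).vtx 0 = vec2 0 0) (hv1 : ∀ n, (P n).vtx 1 = vec2 1 0)
    (Ωinf : Set Pt) (hΩ : Ωinf = limitDomain (fun n => (P n).Ω))
    (hopen : IsOpen Ωinf) (hconv : Convex ℝ Ωinf) (hne : Ωinf.Nonempty)
    (hunb : ¬ Bornology.IsBounded Ωinf)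
    (hpq : ∃ p q : Pt, IsEvenVertex P p ∧ IsOddVertex P q ∧ p ≠ q ∧
      ¬ (dist p q = 1 ∧ segment ℝ p q ⊆ frontier Ωinf) ∧
      0 < ‖p - q‖ ∧ ‖p - q‖ ≤ 1) :
    IsStrip Ωinf ∨ IsSpecialUnbounded Ωinf := by
  obtain ⟨p, q, ⟨ip, hip, hip'⟩, ⟨iq, hiq, hiq'⟩, hne', hnc, hd0, hd1⟩ := hpq
  -- natural number indices
  set I : ℕ → ℕ := fun n => (ip n).val with hI
  have hNZ : ∀ n : ℕ, NeZero (2 * (n + 2)) := fun n => ⟨by omega⟩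
  have hJex : ∀ n, ∃ j : ℕ, I n < j ∧ j < I n + 2 * (n + 2) ∧ Odd (j - I n) ∧
      (P n).V j = (P n).vtx (iq n) := by
    intro n
    have := hNZ n
    have h1 : I n < 2 * (n + 2) := ZMod.val_lt (ip n)
    have h2 : (iq n).val < 2 * (n + 2) := ZMod.val_lt (iq n)
    have h3 : I n % 2 = 0 := Nat.even_iff.1 (hip n)
    have h4 : (iq n).val % 2 = 1 := Nat.not_even_iff.1 (hiq n)
    have hV : (P n).V (iq n).val = (P n).vtx (iq n) := by
      unfold UnitPolygon.V
      rw [ZMod.natCast_zmod_val]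
    by_cases hlt : I n < (iq n).val
    · exact ⟨(iq n).val, hlt, by omega, Nat.odd_iff.2 (by omega), hV⟩
    · exact ⟨(iq n).val + 2 * (n + 2), by omega, by omega, Nat.odd_iff.2 (by omega), by
        rw [(P n).V_add, hV]⟩
  choose J hJ1 hJ2 hJ3 hJ4 using hJex
  have hp : Tendsto (fun n => (P n).V (I n)) atTop (𝓝 p) := by
    refine hip'.congr fun n => ?_
    have := hNZ n
    unfold UnitPolygon.V
    rw [hI, ZMod.natCast_zmod_val]
  have hq : Tendsto (fun n => (P n).V (J n)) atTop (𝓝 q) := hiq'.congr fun n => (hJ4 n).symm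
  have hge : 1 ≤ dist p q := ge_of_tendsto (hp.dist hq)
    (Eventually.of_forall fun n => (P n).one_le_dist (hJ1 n) (hJ2 n) (hJ3 n))
  have hd : ‖p - q‖ = 1 := by rw [dist_eq_norm] at hge; exact le_antisymm hd1 hge
  have hVc : ∀ (r : ℕ → ℕ) (z : Pt), Tendsto (fun n => (P n).V (r n)) atTop (𝓝 z) →
      z ∈ closure Ωinf ∧ z ∉ Ωinf := by
    intro r z hz
    subst hΩ
    refine ⟨limit_closure (fun n => (P n).convex) (fun n => (P n).isOpen) hne
      (fun n => (P n).V_closure _) hz, fun hmem => ?_⟩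
    obtain ⟨n, hn⟩ := (limit_eventually_mem hmem le_rfl hz).exists
    exact (P n).V_not_mem _ hn
  obtain ⟨hpc, hpn⟩ := hVc _ _ hp
  obtain ⟨hqc, hqn⟩ := hVc _ _ hq
  obtain ⟨x0, hx0, hx0'⟩ : ∃ x ∈ segment ℝ p q, x ∈ Ωinf := by
    have hns : ¬ segment ℝ p q ⊆ frontier Ωinf := fun h => hnc ⟨by rw [dist_eq_norm, hd], h⟩
    rw [not_subset] at hns
    obtain ⟨x, hx, hxf⟩ := hns
    refine ⟨x, hx, ?_⟩
    have hxc : x ∈ closure Ωinf := hconv.closure.segment_subset hpc hqc hx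
    rw [hopen.frontier_eq] at hxf
    by_contra hc
    exact hxf ⟨hxc, hc⟩
  obtain ⟨w, hw, hrec⟩ := exists_recession hopen hconv hne hunb
  have hcr : cross2 (p - q) w ≠ 0 := by
    intro h0
    have hx := hx0
    rw [segment_eq_image'] at hx
    obtain ⟨t, ht, hxt⟩ := hx
    rcases unit_parallel hd hw h0 with h1 | h1
    · apply hpn
      have := hrec x0 hx0' t ht.1
      rw [← h1, ← hxt] at this
      convert this using 1
      module
    · apply hqn
      have h2 : w = q - p := by rw [← neg_sub, h1, neg_neg]
      have := hrec x0 hx0' (1 - t) (by linarith [ht.2])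
      rw [h2, ← hxt] at this
      convert this using 1
      module
  rcases lt_or_gt_of_ne hcr with hneg | hpos
  · -- swap the roles
    refine core P Ωinf hΩ hopen hconv hne J (fun n => I n + 2 * (n + 2))
      (fun n => (J n - I n - 1) / 2) hJ2 ?_ (p := q) (q := p) (x0 := x0) hq ?_
      (by rw [norm_sub_rev]; exact hd) (by rw [segment_symm]; exact hx0) hx0' hw hrec ?_
    · intro n
      have h1 := hJ1 n
      have h2 := Nat.odd_iff.1 (hJ3 n)
      omega
    · exact hp.congr fun n => ((P n).V_add _).symm
    · simp only [cross2, PiLp.sub_apply] at hneg ⊢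
      linarith
  · refine core P Ωinf hΩ hopen hconv hne I J
      (fun n => (I n + 2 * (n + 2) - J n - 1) / 2) hJ1 ?_ hp hq hd hx0 hx0' hw hrec hpos
    intro n
    have h1 := hJ1 n
    have h2 := hJ2 n
    have h3 := Nat.odd_iff.1 (hJ3 n)
    omega
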